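/- (Expected number of real eigenvalues as a Hermite integral.) For every τ ∈ [0,1] and every even integer N ≥ 2: ∫_ℝ R_N(x) dx = √(2/π) · Σ_{k=0}^{N/2−1} (1/(2k)!) · ∫_ℝ e^{−x²/(1+τ)} · C_{2k}(x)² dx. -/

import Mathlib

open Real MeasureTheory Finset

/-- The rescaled (monic-type) Hermite polynomials `C_k` with parameter `τ`:
`C_0(x) = 1`, `C_1(x) = x`, `C_{k+1}(x) = x·C_k(x) − k·τ·C_{k−1}(x)`. -/
noncomputable def CH (τ : ℝ) : ℕ → ℝ → ℝ
  | 0 => fun _ => 1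
  | 1 => fun x => x
  | (k+2) => fun x => x * CH τ (k+1) x - ((k : ℝ) + 1) * τ * CH τ k x

/-- The elliptic GinUE part `R_N^{(1)}` of the real-eigenvalue density. -/
noncomputable def R1 (τ : ℝ) (N : ℕ) (x : ℝ) : ℝ :=
  (Real.exp (-x^2/(1+τ)) / Real.sqrt (2*Real.pi)) *
    ∑ k ∈ Finset.range (N-1), (CH τ k x)^2 / (Nat.factorial k : ℝ)

/-- The correction part `R_N^{(2)}` of the real-eigenvalue density. -/
noncomputable def R2 (τ : ℝ) (N : ℕ) (x : ℝ) : ℝ :=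
  (1/((1+τ) * (Nat.factorial (N-2) : ℝ))) * (Real.exp (-x^2/(2*(1+τ))) / Real.sqrt (2*Real.pi)) *
    CH τ (N-1) x * (∫ u in (0:ℝ)..x, Real.exp (-u^2/(2*(1+τ))) * CH τ (N-2) u)

/-- The density `R_N` of real eigenvalues of the elliptic GinOE. -/
noncomputable def Rd (τ : ℝ) (N : ℕ) (x : ℝ) : ℝ := R1 τ N x + R2 τ N x

/-- The moment generating function of real eigenvalues of the elliptic GinOE. -/
noncomputable def MGF (τ : ℝ) (N : ℕ) (t : ℝ) : ℝ := ∫ x : ℝ, Real.exp (t*x) * Rd τ N x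

/-- The `p`-th spectral moment of real eigenvalues of the elliptic GinOE. -/
noncomputable def Mom (τ : ℝ) (N : ℕ) (p : ℕ) : ℝ := ∫ x : ℝ, x^p * Rd τ N x

/-- The elliptic GinUE part `u` of the moment generating function. -/
noncomputable def uF (τ : ℝ) (N : ℕ) (t : ℝ) : ℝ := ∫ x : ℝ, Real.exp (t*x) * R1 τ N x

/-- The part `v` of the moment generating function coming from `R_N^{(2)}`. -/
noncomputable def vF (τ : ℝ) (N : ℕ) (t : ℝ) : ℝ := ∫ x : ℝ, Real.exp (t*x) * R2 τ N x
/-- The weighted polynomials `exp (-x² / (2(1+τ))) * C_k(x)`. -/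
noncomputable def weightedCH (τ : ℝ) (k : ℕ) (x : ℝ) : ℝ :=
  Real.exp (-x^2/(2*(1+τ))) * CH τ k x

/-- The primitive of `weightedCH` vanishing at the origin. -/
noncomputable def weightedPrimitive (τ : ℝ) (k : ℕ) (x : ℝ) : ℝ :=
  ∫ u in (0:ℝ)..x, weightedCH τ k u

theorem CH_add_two (τ : ℝ) (k : ℕ) (x : ℝ) :
    CH τ (k+2) x = x * CH τ (k+1) x - ((k : ℝ) + 1) * τ * CH τ k x := by
  simp only [CH]

theorem CH_eq_polynomial_eval (τ : ℝ) (k : ℕ) :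
    ∃ p : Polynomial ℝ, ∀ x, CH τ k x = p.eval x := by
  induction k using Nat.twoStepInduction with
  | zero => exact ⟨1, fun x => by simp [CH]⟩
  | one => exact ⟨Polynomial.X, fun x => by simp [CH]⟩
  | more k ih₀ ih₁ =>
    obtain ⟨p, hp⟩ := ih₀
    obtain ⟨q, hq⟩ := ih₁
    exact ⟨Polynomial.X * q - Polynomial.C (((k : ℝ) + 1) * τ) * p,
      fun x => by simp [CH_add_two, hp, hq]⟩

theorem hasDerivAt_CH_succ (τ : ℝ) (k : ℕ) (x : ℝ) :
    HasDerivAt (CH τ (k+1)) (((k : ℝ) + 1) * CH τ k x) x := by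
  induction k using Nat.twoStepInduction with
  | zero => simpa [CH] using hasDerivAt_id' x
  | one =>
    have h : HasDerivAt (fun y : ℝ => y * y - τ) (1 * x + x * 1) x :=
      ((hasDerivAt_id x).mul (hasDerivAt_id x)).sub_const τ
    convert h using 1
    · ext y; simp [CH]
    · simp [CH]; ring
  | more k ih₀ ih₁ =>
    have h := ((hasDerivAt_id x).mul ih₁).sub (ih₀.const_mul (((k + 1 : ℕ) + 1 : ℝ) * τ))
    have hC : CH τ (k+2+1)
        = id * CH τ (k+1+1) - fun y => (((k + 1 : ℕ) : ℝ) + 1) * τ * CH τ (k+1) y := by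
      ext y
      exact CH_add_two τ (k+1) y
    rw [hC]
    refine h.congr_deriv ?_
    simp only [CH_add_two τ k x, id]
    push_cast
    ring

theorem CH_odd_zero (τ : ℝ) (j : ℕ) : CH τ (2*j+1) 0 = 0 := by
  induction j with
  | zero => simp [CH]
  | succ j ih => simp [show 2*(j+1)+1 = (2*j+1)+2 by ring, CH_add_two, ih]

theorem integrable_polynomial_mul_exp_neg_mul_sq {b : ℝ} (hb : 0 < b) (p : Polynomial ℝ) :
    Integrable (fun x : ℝ => p.eval x * Real.exp (-b * x^2)) := by
  induction p using Polynomial.induction_on' with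
  | add p q hp hq =>
    simp only [Polynomial.eval_add, add_mul]
    exact hp.add hq
  | monomial n a =>
    have h := integrable_rpow_mul_exp_neg_mul_sq hb (s := n)
      (by have : (0 : ℝ) ≤ n := n.cast_nonneg
          linarith)
    simpa [mul_assoc] using h.const_mul a

variable {τ : ℝ}

theorem integrable_weightedCH (hτ : 0 < 1 + τ) (k : ℕ) : Integrable (weightedCH τ k) := by
  obtain ⟨p, hp⟩ := CH_eq_polynomial_eval τ k
  have h := integrable_polynomial_mul_exp_neg_mul_sq (b := 1/(2*(1+τ))) (by positivity) p
  convert h using 2 with x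
  rw [weightedCH, hp, mul_comm]
  congr 2
  ring

theorem exp_mul_CH_mul_CH (τ : ℝ) (j k : ℕ) (x : ℝ) :
    Real.exp (-x^2/(1+τ)) * (CH τ j x * CH τ k x) = weightedCH τ j x * weightedCH τ k x := by
  have h : Real.exp (-x^2/(1+τ))
      = Real.exp (-x^2/(2*(1+τ))) * Real.exp (-x^2/(2*(1+τ))) := by
    rw [← Real.exp_add]
    congr 1
    rw [mul_comm 2 (1+τ), ← div_div]
    ring
  rw [h, weightedCH, weightedCH]
  ring

theorem integrable_weightedCH_mul (hτ : 0 < 1 + τ) (j k : ℕ) :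
    Integrable (fun x => weightedCH τ j x * weightedCH τ k x) := by
  obtain ⟨p, hp⟩ := CH_eq_polynomial_eval τ j
  obtain ⟨q, hq⟩ := CH_eq_polynomial_eval τ k
  have h := integrable_polynomial_mul_exp_neg_mul_sq (b := 1/(1+τ)) (by positivity) (p * q)
  convert h using 2 with x
  rw [← exp_mul_CH_mul_CH, hp, hq, mul_comm, Polynomial.eval_mul]
  congr 2
  ring

theorem hasDerivAt_weightedCH_succ (hτ : 0 < 1 + τ) (k : ℕ) (x : ℝ) :
    HasDerivAt (weightedCH τ (k+1))
      ((((k : ℝ) + 1) * weightedCH τ k x - weightedCH τ (k+2) x) / (1+τ)) x := by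
  have he : HasDerivAt (fun y : ℝ => Real.exp (-y^2/(2*(1+τ))))
      (Real.exp (-x^2/(2*(1+τ))) * (-(2 * x) / (2*(1+τ)))) x := by
    simpa using (((hasDerivAt_pow 2 x).neg).div_const (2*(1+τ))).exp
  refine (he.mul (hasDerivAt_CH_succ τ k x)).congr_deriv ?_
  simp only [weightedCH, CH_add_two]
  field_simp
  ring

theorem hasDerivAt_weightedCH_zero (hτ : 0 < 1 + τ) (x : ℝ) :
    HasDerivAt (weightedCH τ 0) (-weightedCH τ 1 x / (1+τ)) x := by
  have he : HasDerivAt (fun y : ℝ => Real.exp (-y^2/(2*(1+τ))))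
      (Real.exp (-x^2/(2*(1+τ))) * (-(2 * x) / (2*(1+τ)))) x := by
    simpa using (((hasDerivAt_pow 2 x).neg).div_const (2*(1+τ))).exp
  convert he using 1
  · ext y; simp [weightedCH, CH]
  · simp only [weightedCH, CH]
    field_simp

theorem continuous_weightedCH (τ : ℝ) (k : ℕ) : Continuous (weightedCH τ k) := by
  obtain ⟨p, hp⟩ := CH_eq_polynomial_eval τ k
  have h : weightedCH τ k = fun x => Real.exp (-x^2/(2*(1+τ))) * p.eval x := by
    ext x; rw [weightedCH, hp]
  rw [h]
  fun_prop

theorem hasDerivAt_weightedPrimitive (τ : ℝ) (k : ℕ) (x : ℝ) :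
    HasDerivAt (weightedPrimitive τ k) (weightedCH τ k x) x :=
  ((continuous_weightedCH τ k).integral_hasStrictDerivAt 0 x).hasDerivAt

theorem abs_weightedPrimitive_le (hτ : 0 < 1 + τ) (k : ℕ) (x : ℝ) :
    ‖weightedPrimitive τ k x‖ ≤ ∫ u, ‖weightedCH τ k u‖ :=
  intervalIntegral.norm_integral_le_integral_norm_uIoc.trans
    (setIntegral_le_integral (integrable_weightedCH hτ k).norm
      (Filter.Eventually.of_forall fun _ => norm_nonneg _))

theorem integrable_weightedCH_mul_weightedPrimitive (hτ : 0 < 1 + τ) (j k : ℕ) :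
    Integrable (fun x => weightedCH τ j x * weightedPrimitive τ k x) :=
  (integrable_weightedCH hτ j).mul_bdd (c := ∫ u, ‖weightedCH τ k u‖)
    (continuous_iff_continuousAt.2 fun x =>
      (hasDerivAt_weightedPrimitive τ k x).continuousAt).aestronglyMeasurable
    (Filter.Eventually.of_forall (abs_weightedPrimitive_le hτ k))

/-- Recursion for the primitives: `Φ_{k+2} = (k+1) Φ_k - (1+τ) (φ_{k+1} - φ_{k+1}(0))`. -/
theorem weightedPrimitive_add_two (hτ : 0 < 1 + τ) (k : ℕ) (x : ℝ) :
    weightedPrimitive τ (k+2) x = ((k : ℝ) + 1) * weightedPrimitive τ k x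
      - (1+τ) * (weightedCH τ (k+1) x - weightedCH τ (k+1) 0) := by
  have hi : ∀ m, IntervalIntegrable (weightedCH τ m) volume 0 x := fun m =>
    (continuous_weightedCH τ m).intervalIntegrable 0 x
  have h := intervalIntegral.integral_eq_sub_of_hasDerivAt
    (fun y _ => hasDerivAt_weightedCH_succ hτ k y)
    ((((hi k).const_mul ((k : ℝ) + 1)).sub (hi (k+2))).div_const (1+τ))
  rw [intervalIntegral.integral_div, intervalIntegral.integral_sub ((hi k).const_mul _) (hi _),
    intervalIntegral.integral_const_mul, div_eq_iff hτ.ne'] at h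
  simp only [weightedPrimitive]
  linarith

theorem integral_weightedCH_add_two_mul_weightedPrimitive (hτ : 0 < 1 + τ) (k m : ℕ) :
    ∫ x, weightedCH τ (k+2) x * weightedPrimitive τ m x
      = ((k : ℝ) + 1) * (∫ x, weightedCH τ k x * weightedPrimitive τ m x)
        + (1+τ) * ∫ x, weightedCH τ (k+1) x * weightedCH τ m x := by
  have hi := integrable_weightedCH_mul_weightedPrimitive hτ (k := m)
  have hd : ∀ x, (((k : ℝ) + 1) * weightedCH τ k x - weightedCH τ (k+2) x) / (1+τ)
        * weightedPrimitive τ m x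
      = (((k : ℝ) + 1) * (weightedCH τ k x * weightedPrimitive τ m x)
        - weightedCH τ (k+2) x * weightedPrimitive τ m x) / (1+τ) := fun x => by ring
  have h := integral_mul_deriv_eq_deriv_mul_of_integrable
    (fun x _ => hasDerivAt_weightedCH_succ hτ k x)
    (fun x _ => hasDerivAt_weightedPrimitive τ m x)
    (integrable_weightedCH_mul hτ (k+1) m)
    ((((hi k).const_mul ((k : ℝ) + 1)).sub (hi (k+2))).div_const (1+τ)
      |>.congr (Filter.Eventually.of_forall fun x => (hd x).symm))
    (hi (k+1))
  simp only [hd] at h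
  rw [integral_div, integral_sub ((hi k).const_mul _) (hi _), integral_const_mul] at h
  rw [h]
  field_simp
  ring

theorem integral_weightedCH_one_mul_weightedPrimitive (hτ : 0 < 1 + τ) (m : ℕ) :
    ∫ x, weightedCH τ 1 x * weightedPrimitive τ m x
      = (1+τ) * ∫ x, weightedCH τ 0 x * weightedCH τ m x := by
  have hi := integrable_weightedCH_mul_weightedPrimitive hτ (k := m)
  have hd : ∀ x, -weightedCH τ 1 x / (1+τ) * weightedPrimitive τ m x
      = -(weightedCH τ 1 x * weightedPrimitive τ m x) / (1+τ) := fun x => by ring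
  have h := integral_mul_deriv_eq_deriv_mul_of_integrable
    (fun x _ => hasDerivAt_weightedCH_zero hτ x)
    (fun x _ => hasDerivAt_weightedPrimitive τ m x)
    (integrable_weightedCH_mul hτ 0 m)
    ((hi 1).neg.div_const (1+τ) |>.congr (Filter.Eventually.of_forall fun x => (hd x).symm))
    (hi 0)
  simp only [hd] at h
  rw [integral_div, integral_neg] at h
  rw [h]
  field_simp

theorem integral_weightedCH_odd_mul_weightedPrimitive_add_two (hτ : 0 < 1 + τ) (j : ℕ) :
    ∫ x, weightedCH τ (2*j+1) x * weightedPrimitive τ (2*j+2) x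
      = (2*(j:ℝ)+1) * (∫ x, weightedCH τ (2*j+1) x * weightedPrimitive τ (2*j) x)
        - (1+τ) * ∫ x, weightedCH τ (2*j+1) x * weightedCH τ (2*j+1) x := by
  rw [← integral_const_mul, ← integral_const_mul, ← integral_sub
    ((integrable_weightedCH_mul_weightedPrimitive hτ _ _).const_mul _)
    ((integrable_weightedCH_mul hτ _ _).const_mul _)]
  congr 1 with x
  have h0 : weightedCH τ (2*j+1) 0 = 0 := by simp [weightedCH, CH_odd_zero]
  rw [weightedPrimitive_add_two hτ, h0]
  push_cast
  ring

/-- The correction term as an alternating sum of squared norms. -/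
theorem integral_weightedCH_mul_weightedPrimitive_even (hτ : 0 < 1 + τ) (j : ℕ) :
    ∫ x, weightedCH τ (2*j+1) x * weightedPrimitive τ (2*j) x
      = (1+τ) * ((2*j).factorial : ℝ) * ∑ k ∈ Finset.range (2*j+1),
          (-1)^k * ((∫ x, weightedCH τ k x * weightedCH τ k x) / (k.factorial : ℝ)) := by
  induction j with
  | zero => simp [integral_weightedCH_one_mul_weightedPrimitive hτ]
  | succ j ih =>
    have h1 := integral_weightedCH_add_two_mul_weightedPrimitive hτ (2*j+1) (2*j+2)
    rw [integral_weightedCH_odd_mul_weightedPrimitive_add_two hτ, ih] at h1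
    rw [show 2*(j+1)+1 = 2*j+1+2 by ring, show 2*(j+1) = 2*j+2 by ring, h1,
      Finset.sum_range_succ _ (2*j+2), Finset.sum_range_succ _ (2*j+1)]
    have hp : (-1:ℝ)^(2*j) = 1 := by simp [pow_mul]
    have hf : ((2*j).factorial : ℝ) ≠ 0 := by positivity
    simp only [pow_succ, hp, Nat.factorial_succ]
    push_cast
    have h2 : (2*(j:ℝ)+1) ≠ 0 := by positivity
    have h3 : (2*(j:ℝ)+1+1) ≠ 0 := by positivity
    field_simp
    ring

theorem sum_add_alternating_sum (f : ℕ → ℝ) (j : ℕ) :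
    ∑ k ∈ Finset.range (2*j+1), f k + ∑ k ∈ Finset.range (2*j+1), (-1)^k * f k
      = 2 * ∑ k ∈ Finset.range (j+1), f (2*k) := by
  induction j with
  | zero => simp; ring
  | succ j ih =>
    rw [show 2*(j+1)+1 = 2*j+1+1+1 by ring, Finset.sum_range_succ _ (j+1), mul_add, ← ih]
    have hp : (-1:ℝ)^(2*j) = 1 := by simp [pow_mul]
    simp only [Finset.sum_range_succ _ (2*j+1+1), Finset.sum_range_succ _ (2*j+1), pow_succ, hp,
      show 2*(j+1) = 2*j+1+1 by ring]
    ring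

theorem R1_eq (τ : ℝ) (N : ℕ) (x : ℝ) :
    R1 τ N x = 1 / √(2*π) * ∑ k ∈ Finset.range (N-1),
      (weightedCH τ k x * weightedCH τ k x) / (k.factorial : ℝ) := by
  simp only [R1, ← exp_mul_CH_mul_CH, Finset.mul_sum]
  exact Finset.sum_congr rfl fun k _ => by ring

theorem R2_eq (τ : ℝ) (N : ℕ) (x : ℝ) :
    R2 τ N x = 1 / √(2*π) * (1 / ((1+τ) * ((N-2).factorial : ℝ))
      * (weightedCH τ (N-1) x * weightedPrimitive τ (N-2) x)) := by
  simp only [R2, weightedPrimitive, weightedCH]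
  ring

theorem sqrt_two_div_pi : √(2/π) = 1 / √(2*π) * 2 := by
  rw [Real.sqrt_div zero_le_two, Real.sqrt_mul zero_le_two]
  have h : √2 * √2 = 2 := Real.mul_self_sqrt zero_le_two
  have hpi : √π ≠ 0 := (Real.sqrt_pos.2 Real.pi_pos).ne'
  field_simp
  nlinarith

/-- **Theorem (Expected number of real eigenvalues as a Hermite integral).**
`∫_ℝ R_N(x) dx = √(2/π)·Σ_{k=0}^{N/2−1} (1/(2k)!)·∫_ℝ e^{−x²/(1+τ)}·C_{2k}(x)² dx`. -/
theorem expected_number_real_eigenvalues (τ : ℝ) (hτ : τ ∈ Set.Icc (0:ℝ) 1)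
    (N : ℕ) (hNeven : Even N) (hN2 : 2 ≤ N) :
    ∫ x : ℝ, Rd τ N x
      = Real.sqrt (2/Real.pi) *
          ∑ k ∈ Finset.range (N/2),
            (1/(Nat.factorial (2*k) : ℝ)) *
              ∫ x : ℝ, Real.exp (-x^2/(1+τ)) * (CH τ (2*k) x)^2 := by
  obtain ⟨j, rfl⟩ : ∃ j, N = 2*j+2 := by
    obtain ⟨m, rfl⟩ := hNeven
    exact ⟨m-1, by omega⟩
  have hpos : 0 < 1 + τ := by linarith [hτ.1]
  have hI : ∀ k, Integrable (fun x => weightedCH τ k x * weightedCH τ k x / (k.factorial : ℝ)) :=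
    fun k => (integrable_weightedCH_mul hpos k k).div_const _
  have hR1 : Integrable (R1 τ (2*j+2)) := by
    simp only [funext (R1_eq τ (2*j+2))]
    exact (integrable_finsetSum _ fun k _ => hI k).const_mul _
  have hR2 : Integrable (R2 τ (2*j+2)) := by
    simp only [funext (R2_eq τ (2*j+2))]
    exact ((integrable_weightedCH_mul_weightedPrimitive hpos _ _).const_mul _).const_mul _
  simp only [Rd]
  rw [integral_add hR1 hR2]
  simp only [R1_eq, R2_eq, sq (CH _ _ _), exp_mul_CH_mul_CH]
  rw [integral_const_mul, integral_const_mul, integral_const_mul,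
    integral_finsetSum _ fun k _ => hI k]
  simp only [integral_div, show 2*j+2-1 = 2*j+1 by omega, show 2*j+2-2 = 2*j by omega,
    show (2*j+2)/2 = j+1 by omega, one_div_mul_eq_div _ (∫ _, _)]
  have hf : (1+τ) * ((2*j).factorial : ℝ) ≠ 0 := by positivity
  rw [integral_weightedCH_mul_weightedPrimitive_even hpos, mul_div_cancel_left₀ _ hf, ← mul_add,
    sum_add_alternating_sum, sqrt_two_div_pi, mul_assoc]
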